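/- Let (R,m) be a Noetherian local ring with injective hull E of the residue field R/m. Then the following four ideals of R coincide: the intersection over all Artinian R-modules M of ann_R lic(0,M); the intersection over all finite length R-modules M of ann_R lic(0,M); the intersection over all finitely generated R-modules M of ann_R lic(0,M); and ann_R lic(0,E). (This common ideal is denoted τ_M.) -/

import Mathlib

/- # Liftable integral closure: core definitions

Free $R$-modules are modeled as `ι →₀ R`, and the symmetric algebra of `ι →₀ R`
is modeled as `MvPolynomial ι R`, with the canonical degree-one embedding sending
the basis vector at `i` to the variable `X i`. -/

noncomputable section

open scoped TensorProduct

namespace LIC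

variable (R : Type*) [CommRing R]

/-- The canonical embedding of the free module `ι →₀ R` onto the degree-one part of its
symmetric algebra `MvPolynomial ι R`. -/
def symEmb (ι : Type*) : (ι →₀ R) →ₗ[R] MvPolynomial ι R :=
  Finsupp.linearCombination R MvPolynomial.X

variable {R}

/-- The integral closure `U⁻_F` of a submodule `U` of the free module `F = ι →₀ R`:
the degree-one part of the integral closure, inside the symmetric algebra of `F`,
of the subalgebra generated by `U`. -/
def freeIC {ι : Type*} (U : Submodule R (ι →₀ R)) : Submodule R (ι →₀ R) where
  carrier := {x | IsIntegral (Algebra.adjoin R (symEmb R ι '' U)) (symEmb R ι x)}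
  zero_mem' := by simpa using isIntegral_zero
  add_mem' := by
    intro a b ha hb
    simpa [map_add] using ha.add hb
  smul_mem' := by
    intro c x hx
    have hc : IsIntegral (Algebra.adjoin R (symEmb R ι '' ↑U))
        ((algebraMap R (MvPolynomial ι R)) c) := by
      have : (algebraMap R (MvPolynomial ι R)) c
          = algebraMap (Algebra.adjoin R (symEmb R ι '' ↑U)) (MvPolynomial ι R)
            ⟨(algebraMap R (MvPolynomial ι R)) c,
              Subalgebra.algebraMap_mem _ c⟩ := rfl
      rw [this]
      exact isIntegral_algebraMap
    have : symEmb R ι (c • x) = (algebraMap R (MvPolynomial ι R)) c * symEmb R ι x := by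
      rw [map_smul, Algebra.smul_def]
    simpa [Set.mem_setOf_eq, this] using hc.mul hx
  
/-- The liftable integral closure `lic(L, M)` of a submodule `L ⊆ M`, computed via the
canonical free presentation `M →₀ R ↠ M`.  (By `LIC.lic_indep` this agrees with the
closure computed from any surjection of a free module onto `M`.) -/
def lic {M : Type*} [AddCommGroup M] [Module R M] (L : Submodule R M) : Submodule R M :=
  Submodule.map (Finsupp.linearCombination R (id : M → M))
    (freeIC (Submodule.comap (Finsupp.linearCombination R (id : M → M)) L))

end LIC

end

universe u

namespace LIC

theorem freeIC_map {R : Type*} [CommRing R] {ι κ : Type*} (φ : (ι →₀ R) →ₗ[R] (κ →₀ R))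
    {U : Submodule R (ι →₀ R)} {V : Submodule R (κ →₀ R)} (h : ∀ u ∈ U, φ u ∈ V)
    {x : ι →₀ R} (hx : x ∈ freeIC U) : φ x ∈ freeIC V := by
  let Φ : MvPolynomial ι R →ₐ[R] MvPolynomial κ R :=
    MvPolynomial.aeval (fun i => symEmb R κ (φ (Finsupp.single i 1)))
  have hΦ : ∀ y, Φ (symEmb R ι y) = symEmb R κ (φ y) := by
    intro y
    have : Φ.toLinearMap ∘ₗ symEmb R ι = symEmb R κ ∘ₗ φ := by
      ext1 i
      ext1
      simp [Φ, symEmb]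
    exact LinearMap.congr_fun this y
  have hle : ∀ a ∈ Algebra.adjoin R (symEmb R ι '' (U : Set (ι →₀ R))),
      Φ a ∈ Algebra.adjoin R (symEmb R κ '' (V : Set (κ →₀ R))) := by
    intro a ha
    have : Algebra.adjoin R (symEmb R ι '' (U : Set (ι →₀ R))) ≤
        (Algebra.adjoin R (symEmb R κ '' (V : Set (κ →₀ R)))).comap Φ := by
      apply Algebra.adjoin_le
      rintro _ ⟨u, hu, rfl⟩
      change Φ (symEmb R ι u) ∈ Algebra.adjoin R (symEmb R κ '' (V : Set (κ →₀ R)))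
      rw [hΦ]
      exact Algebra.subset_adjoin ⟨_, h u hu, rfl⟩
    exact this ha
  change IsIntegral _ (symEmb R κ (φ x))
  rw [← hΦ]
  change IsIntegral _ (symEmb R ι x) at hx
  refine IsIntegral.map_of_comp_eq
    (((Φ.comp (Algebra.adjoin R (symEmb R ι '' (U : Set (ι →₀ R)))).val).codRestrict
      (Algebra.adjoin R (symEmb R κ '' (V : Set (κ →₀ R))))
      (fun a => hle a a.2))).toRingHom Φ.toRingHom ?_ hx
  ext a <;> rfl

theorem exists_finite_adjoin {R A : Type*} [CommRing R] [CommRing A] [Algebra R A] (s : Set A)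
    {a : A} (ha : a ∈ Algebra.adjoin R s) :
    ∃ t ⊆ s, t.Finite ∧ a ∈ Algebra.adjoin R t := by
  induction ha using Algebra.adjoin_induction with
  | mem x hx => exact ⟨{x}, by simpa using hx, Set.finite_singleton x,
      Algebra.subset_adjoin rfl⟩
  | algebraMap r => exact ⟨∅, by simp, Set.finite_empty, Subalgebra.algebraMap_mem _ r⟩
  | add x y _ _ hx hy =>
    obtain ⟨t, h1, h2, h3⟩ := hx
    obtain ⟨u, k1, k2, k3⟩ := hy
    exact ⟨t ∪ u, Set.union_subset h1 k1, h2.union k2,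
      add_mem (Algebra.adjoin_mono Set.subset_union_left h3)
        (Algebra.adjoin_mono Set.subset_union_right k3)⟩
  | mul x y _ _ hx hy =>
    obtain ⟨t, h1, h2, h3⟩ := hx
    obtain ⟨u, k1, k2, k3⟩ := hy
    exact ⟨t ∪ u, Set.union_subset h1 k1, h2.union k2,
      mul_mem (Algebra.adjoin_mono Set.subset_union_left h3)
        (Algebra.adjoin_mono Set.subset_union_right k3)⟩

theorem freeIC_finite {R : Type*} [CommRing R] {ι : Type*}
    {U : Submodule R (ι →₀ R)} {x : ι →₀ R} (hx : x ∈ freeIC U) :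
    ∃ T : Set (ι →₀ R), T ⊆ U ∧ T.Finite ∧ x ∈ freeIC (Submodule.span R T) := by
  change IsIntegral _ (symEmb R ι x) at hx
  obtain ⟨s, hs, hint⟩ := isIntegral_iff_isIntegral_closure_finite.1 hx
  choose t ht1 ht2 ht3 using fun a : Algebra.adjoin R (symEmb R ι '' (U : Set (ι →₀ R))) =>
    exists_finite_adjoin _ a.2
  have hfin : (⋃ a ∈ s, t a).Finite := hs.biUnion (fun a _ => ht2 a)
  have hsub : (⋃ a ∈ s, t a) ⊆ symEmb R ι '' (U : Set (ι →₀ R)) :=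
    Set.iUnion₂_subset (fun a _ => ht1 a)
  obtain ⟨T, hT, hTfin, hTeq⟩ := Set.exists_subset_image_finite_and.1
    ⟨_, hsub, hfin, (rfl : (⋃ a ∈ s, t a) = ⋃ a ∈ s, t a)⟩
  replace hTeq : symEmb R ι '' T = ⋃ a ∈ s, t a := by first | exact hTeq | exact hTeq.symm
  refine ⟨T, hT, hTfin, ?_⟩
  have key : ∀ a ∈ Subring.closure s, (a : MvPolynomial ι R) ∈
      Algebra.adjoin R (symEmb R ι '' (Submodule.span R T : Set (ι →₀ R))) := by
    intro a ha
    have : Subring.closure s ≤ (Algebra.adjoin R (symEmb R ι ''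
        (Submodule.span R T : Set (ι →₀ R)))).toSubring.comap
        (algebraMap (Algebra.adjoin R (symEmb R ι '' (U : Set (ι →₀ R))))
          (MvPolynomial ι R)) := by
      rw [Subring.closure_le]
      intro b hb
      change (b : MvPolynomial ι R) ∈ Algebra.adjoin R _
      refine Algebra.adjoin_mono ?_ (ht3 b)
      refine (Set.subset_biUnion_of_mem hb).trans ?_
      rw [← hTeq]
      exact Set.image_mono Submodule.subset_span
    exact this ha
  change IsIntegral _ (symEmb R ι x)
  refine IsIntegral.map_of_comp_eq
    (RingHom.codRestrict ((algebraMap (Algebra.adjoin R (symEmb R ι '' (U : Set (ι →₀ R))))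
          (MvPolynomial ι R)).comp (Subring.closure s).subtype)
      (Algebra.adjoin R (symEmb R ι '' (Submodule.span R T : Set (ι →₀ R))))
      (fun a => key a a.2)) (RingHom.id _) ?_ hint
  ext a; rfl

theorem lic_map {R : Type*} [CommRing R] {M N : Type*} [AddCommGroup M] [Module R M]
    [AddCommGroup N] [Module R N] (f : M →ₗ[R] N) {z : M} (hz : z ∈ lic (⊥ : Submodule R M)) :
    f z ∈ lic (⊥ : Submodule R N) := by
  obtain ⟨x, hx, rfl⟩ := hz
  have hc : ∀ y, Finsupp.linearCombination R (id : N → N) (Finsupp.lmapDomain R R f y) =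
      f (Finsupp.linearCombination R (id : M → M) y) := by
    intro y
    have : Finsupp.linearCombination R (id : N → N) ∘ₗ (Finsupp.lmapDomain R R f) =
      f ∘ₗ (Finsupp.linearCombination R (id : M → M)) := by
      ext1 i
      ext1
      simp
    exact LinearMap.congr_fun this y
  refine ⟨Finsupp.lmapDomain R R f x, freeIC_map _ ?_ hx, hc x⟩
  intro u hu
  have hu' : Finsupp.linearCombination R (id : M → M) u = 0 := by simpa using hu
  simp only [Submodule.mem_comap, Submodule.mem_bot]
  rw [hc, hu', map_zero]

theorem lic_finite {R : Type*} [CommRing R] {M : Type*} [AddCommGroup M] [Module R M]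
    {z : M} (hz : z ∈ lic (⊥ : Submodule R M)) :
    ∃ N : Submodule R M, N.FG ∧ ∃ w : N, w ∈ lic (⊥ : Submodule R N) ∧ (w : M) = z := by
  classical
  obtain ⟨x, hx, rfl⟩ := hz
  obtain ⟨T, hTU, hT, hxT⟩ := freeIC_finite hx
  let S : Set M := (x.support : Set M) ∪ ⋃ u ∈ T, (u.support : Set M)
  have hS : S.Finite := (Finset.finite_toSet _).union (hT.biUnion fun u _ => Finset.finite_toSet _)
  let N := Submodule.span R S
  let ρ : (M →₀ R) →ₗ[R] (N →₀ R) := Finsupp.linearCombination R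
    (fun m => if h : m ∈ N then Finsupp.single (⟨m, h⟩ : N) (1 : R) else 0)
  have hρ : ∀ y : M →₀ R, (y.support : Set M) ⊆ S →
      ((Finsupp.linearCombination R (id : N → N) (ρ y) : N) : M) =
        Finsupp.linearCombination R (id : M → M) y := by
    intro y hy
    have h1 : ((Finsupp.linearCombination R (id : N → N) (ρ y) : N) : M) =
        (N.subtype ∘ₗ Finsupp.linearCombination R (id : N → N)) (ρ y) := rfl
    rw [h1]
    simp only [ρ, Finsupp.linearCombination_apply (R := R) (l := y), Finsupp.sum, map_sum, map_smul]
    refine Finset.sum_congr rfl fun m hm => ?_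
    have : m ∈ N := Submodule.subset_span (hy hm)
    simp [this]
  refine ⟨N, Submodule.fg_span hS, _, ⟨ρ x, freeIC_map ρ ?_ hxT, rfl⟩,
    hρ x Set.subset_union_left⟩
  intro u hu
  refine (Submodule.span_le (p := Submodule.comap ρ (Submodule.comap
    (Finsupp.linearCombination R (id : N → N)) ⊥))).2 ?_ hu
  intro v hv
  have hv' : Finsupp.linearCombination R (id : M → M) v = 0 := by simpa using hTU hv
  have := hρ v ((Set.subset_biUnion_of_mem (u := fun u : M →₀ R => (u.support : Set M)) hv).trans
    Set.subset_union_right)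
  rw [hv'] at this
  simpa using this

theorem finiteLength_quot {R : Type*} [CommRing R] [IsLocalRing R] [IsNoetherianRing R]
    {M : Type*} [AddCommGroup M] [Module R M] [Module.Finite R M] (n : ℕ) :
    IsFiniteLength R (M ⧸ (IsLocalRing.maximalIdeal R ^ n • ⊤ : Submodule R M)) := by
  rw [isFiniteLength_iff_isNoetherian_isArtinian]
  refine ⟨inferInstance, ?_⟩
  rcases Nat.eq_zero_or_pos n with rfl | hn
  · have : Subsingleton (M ⧸ (IsLocalRing.maximalIdeal R ^ 0 • ⊤ : Submodule R M)) := by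
      rw [Submodule.Quotient.subsingleton_iff]; simp
    infer_instance
  have hA : IsArtinianRing (R ⧸ IsLocalRing.maximalIdeal R ^ n) := by
    apply IsLocalRing.quotient_artinian_of_mem_minimalPrimes_of_isLocalRing
    refine ⟨⟨inferInstance, Ideal.pow_le_self hn.ne'⟩, ?_⟩
    rintro p ⟨hp, hle⟩ _
    exact hp.le_of_pow_le hle
  have : Module.Finite (R ⧸ IsLocalRing.maximalIdeal R ^ n)
      (M ⧸ (IsLocalRing.maximalIdeal R ^ n • ⊤ : Submodule R M)) :=
    Module.Finite.of_restrictScalars_finite R _ _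
  exact isArtinian_of_surjective_algebraMap (R := R ⧸ IsLocalRing.maximalIdeal R ^ n)
    Ideal.Quotient.mk_surjective

theorem exists_ne_zero {R : Type u} [CommRing R] [IsLocalRing R]
    (E : Type u) [AddCommGroup E] [Module R E] [Module.Injective R E]
    (j : (R ⧸ IsLocalRing.maximalIdeal R) →ₗ[R] E) (hj : Function.Injective j)
    {M : Type u} [AddCommGroup M] [Module R M] (y : M) (hy : y ≠ 0) :
    ∃ f : M →ₗ[R] E, f y ≠ 0 := by
  let I : Ideal R := LinearMap.ker (LinearMap.toSpanSingleton R M y)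
  have hI : I ≤ IsLocalRing.maximalIdeal R := by
    apply IsLocalRing.le_maximalIdeal
    rw [Ideal.ne_top_iff_one]
    simpa [I] using hy
  let i : (R ⧸ I) →ₗ[R] M := I.liftQ (LinearMap.toSpanSingleton R M y) le_rfl
  have hi : Function.Injective i := by
    rw [← LinearMap.ker_eq_bot]
    exact Submodule.ker_liftQ_eq_bot _ _ _ le_rfl
  obtain ⟨f, hf⟩ := Module.Injective.out i hi (j ∘ₗ Submodule.factor hI)
  refine ⟨f, ?_⟩
  have h1 := hf (Submodule.Quotient.mk 1)
  have h2 : i (Submodule.Quotient.mk 1) = y := (Submodule.liftQ_apply _ _ _).trans (one_smul R y)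
  rw [h2] at h1
  rw [h1]
  intro h0
  have h3 := hj (h0.trans (map_zero j).symm)
  have h4 : (Ideal.Quotient.mk (IsLocalRing.maximalIdeal R) 1) = 0 := h3
  rw [map_one] at h4
  exact one_ne_zero h4

end LIC


/-- Let `(R,m)` be Noetherian local with `E` an injective hull of the
residue field `R/m` (an injective module containing `R/m` as an essential submodule).
Then the following ideals coincide: the intersection of `ann lic(0,M)` over all Artinian
`M`; over all finite length `M`; over all finitely generated `M`; and `ann lic(0,E)`. -/
theorem tau_M_characterizations {R : Type u} [CommRing R] [IsLocalRing R]
    [IsNoetherianRing R]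
    (E : Type u) [AddCommGroup E] [Module R E] [Module.Injective R E]
    (j : (R ⧸ IsLocalRing.maximalIdeal R) →ₗ[R] E) (hj : Function.Injective j)
    (hess : ∀ N : Submodule R E, N ⊓ LinearMap.range j = ⊥ → N = ⊥) :
    sInf {J : Ideal R | ∃ (M : Type u) (_ : AddCommGroup M) (_ : Module R M),
        IsArtinian R M ∧ J = (LIC.lic (⊥ : Submodule R M)).annihilator} =
      sInf {J : Ideal R | ∃ (M : Type u) (_ : AddCommGroup M) (_ : Module R M),
        IsFiniteLength R M ∧ J = (LIC.lic (⊥ : Submodule R M)).annihilator} ∧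
    sInf {J : Ideal R | ∃ (M : Type u) (_ : AddCommGroup M) (_ : Module R M),
        IsFiniteLength R M ∧ J = (LIC.lic (⊥ : Submodule R M)).annihilator} =
      sInf {J : Ideal R | ∃ (M : Type u) (_ : AddCommGroup M) (_ : Module R M),
        Module.Finite R M ∧ J = (LIC.lic (⊥ : Submodule R M)).annihilator} ∧
    sInf {J : Ideal R | ∃ (M : Type u) (_ : AddCommGroup M) (_ : Module R M),
        Module.Finite R M ∧ J = (LIC.lic (⊥ : Submodule R M)).annihilator} =
      (LIC.lic (⊥ : Submodule R E)).annihilator := by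
  have hmem : ∀ (M : Type u) [AddCommGroup M] [Module R M] (r : R),
      r ∈ (LIC.lic (⊥ : Submodule R M)).annihilator ↔
        ∀ z ∈ LIC.lic (⊥ : Submodule R M), r • z = 0 :=
    fun M _ _ r => Submodule.mem_annihilator
  -- the f.g. ideal lies in every annihilator
  have hfall : ∀ (M : Type u) [AddCommGroup M] [Module R M],
      sInf {J : Ideal R | ∃ (M : Type u) (_ : AddCommGroup M) (_ : Module R M),
        Module.Finite R M ∧ J = (LIC.lic (⊥ : Submodule R M)).annihilator} ≤
      (LIC.lic (⊥ : Submodule R M)).annihilator := by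
    intro M _ _ r hr
    rw [hmem]
    intro z hz
    obtain ⟨N, hN, w, hw, rfl⟩ := LIC.lic_finite hz
    have hfin : Module.Finite R N := Module.Finite.iff_fg.2 hN
    have h1 : r ∈ (LIC.lic (⊥ : Submodule R N)).annihilator :=
      (Submodule.mem_sInf.1 hr) _ ⟨N, inferInstance, inferInstance, hfin, rfl⟩
    have h2 := (hmem N r).1 h1 w hw
    rw [← Submodule.coe_smul, h2, Submodule.coe_zero]
  have hflf : sInf {J : Ideal R | ∃ (M : Type u) (_ : AddCommGroup M) (_ : Module R M),
        IsFiniteLength R M ∧ J = (LIC.lic (⊥ : Submodule R M)).annihilator} ≤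
      sInf {J : Ideal R | ∃ (M : Type u) (_ : AddCommGroup M) (_ : Module R M),
        Module.Finite R M ∧ J = (LIC.lic (⊥ : Submodule R M)).annihilator} := by
    refine le_sInf ?_
    rintro J ⟨M, _, _, hM, rfl⟩ r hr
    rw [hmem]
    intro z hz
    have hk := Ideal.iInf_pow_smul_eq_bot_of_isLocalRing (M := M)
      (IsLocalRing.maximalIdeal R) (Ideal.IsPrime.ne_top inferInstance)
    rw [← Submodule.mem_bot R, ← hk, Submodule.mem_iInf]
    intro n
    have h1 := (Submodule.mem_sInf.1 hr) _
      ⟨_, inferInstance, inferInstance, LIC.finiteLength_quot (R := R) (M := M) n, rfl⟩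
    have h2 := (hmem _ r).1 h1 _ (LIC.lic_map (Submodule.mkQ _) hz)
    rw [← map_smul] at h2
    exact (Submodule.Quotient.mk_eq_zero _).1 h2
  have hflE : (LIC.lic (⊥ : Submodule R E)).annihilator ≤
      sInf {J : Ideal R | ∃ (M : Type u) (_ : AddCommGroup M) (_ : Module R M),
        Module.Finite R M ∧ J = (LIC.lic (⊥ : Submodule R M)).annihilator} := by
    refine le_sInf ?_
    rintro J ⟨M, _, _, hM, rfl⟩ r hr
    rw [hmem]
    intro z hz
    by_contra hne
    obtain ⟨f, hf⟩ := LIC.exists_ne_zero E j hj _ hne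
    apply hf
    rw [map_smul]
    exact (hmem E r).1 hr _ (LIC.lic_map f hz)
  have hffl : sInf {J : Ideal R | ∃ (M : Type u) (_ : AddCommGroup M) (_ : Module R M),
        Module.Finite R M ∧ J = (LIC.lic (⊥ : Submodule R M)).annihilator} ≤
      sInf {J : Ideal R | ∃ (M : Type u) (_ : AddCommGroup M) (_ : Module R M),
        IsFiniteLength R M ∧ J = (LIC.lic (⊥ : Submodule R M)).annihilator} := by
    refine le_sInf ?_
    rintro J ⟨M, _, _, hM, rfl⟩
    exact hfall M
  refine ⟨le_antisymm ?_ (hflf.trans ?_), le_antisymm hflf hffl, le_antisymm (hfall E) hflE⟩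
  · refine sInf_le_sInf ?_
    rintro J ⟨M, i1, i2, hM, rfl⟩
    exact ⟨M, i1, i2, (isFiniteLength_iff_isNoetherian_isArtinian.1 hM).2, rfl⟩
  · refine le_sInf ?_
    rintro J ⟨M, _, _, hM, rfl⟩
    exact hfall M
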